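/- Let p_{0k}, p_{1k} ≥ 0 with p_{0k} + p_{1k} = 1 for all k, and suppose there exists p ∈ [1/3, 2/3] such that Σ_{k=1}^∞ (p − p_{0k})² < ∞ (with p_0 = p). Then for Lebesgue-almost every λ ∈ [p^p · (1−p)^{1−p}, 1), the distribution of ψ = Σ_{k=1}^∞ ψ_k λ^k is absolutely continuous with respect to Lebesgue measure on ℝ. -/

import Mathlib

open MeasureTheory

/-- The Bernoulli measure on `Bool` giving mass `p₀` to `false` (value `0`) and
mass `p₁` to `true` (value `1`). -/
noncomputable def bernoulliMeasure (p₀ p₁ : ℝ) : Measure Bool :=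
  ENNReal.ofReal p₀ • Measure.dirac false + ENNReal.ofReal p₁ • Measure.dirac true

/-- `P` is the infinite product of the measures `μ k` on `Bool`: every
finite-dimensional cylinder set gets the product of the coordinate measures. -/
def IsProductMeasure (μ : ℕ → Measure Bool) (P : Measure (ℕ → Bool)) : Prop :=
  ∀ (s : Finset ℕ) (E : ℕ → Set Bool),
    P {ω | ∀ k ∈ s, ω k ∈ E k} = ∏ k ∈ s, μ k (E k)

section Helpers

/-- power series with coefficients `c` -/
noncomputable def ser (c : ℕ → ℝ) (x : ℝ) : ℝ := ∑' k, c k * x ^ k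

lemma ser_summable {c : ℕ → ℝ} {B : ℝ} (hc : ∀ k, |c k| ≤ B) {x : ℝ} (h0 : 0 ≤ x) (h1 : x < 1) :
    Summable (fun k => c k * x ^ k) := by
  have hg : Summable (fun k : ℕ => B * x ^ k) :=
    (summable_geometric_of_lt_one h0 h1).mul_left B
  refine Summable.of_norm_bounded hg (fun k => ?_)
  rw [norm_mul, Real.norm_eq_abs, Real.norm_eq_abs, abs_of_nonneg (pow_nonneg h0 k)]
  exact mul_le_mul_of_nonneg_right (hc k) (pow_nonneg h0 k)

lemma ser_summable' {c : ℕ → ℝ} {B : ℝ} (hc : ∀ k, |c k| ≤ B) {x : ℝ} (h0 : 0 ≤ x) (h1 : x < 1) :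
    Summable (fun k : ℕ => (k : ℝ) * c k * x ^ k) := by
  have hg : Summable (fun k : ℕ => B * ((k : ℝ) ^ 1 * x ^ k)) :=
    (summable_pow_mul_geometric_of_norm_lt_one 1
      (by rw [Real.norm_eq_abs, abs_of_nonneg h0]; exact h1)).mul_left B
  refine Summable.of_norm_bounded hg (fun k => ?_)
  rw [norm_mul, norm_mul, Real.norm_eq_abs, Real.norm_eq_abs, Real.norm_eq_abs,
    abs_of_nonneg (pow_nonneg h0 k), Nat.abs_cast, pow_one]
  have := mul_le_mul_of_nonneg_right (hc k) (mul_nonneg (Nat.cast_nonneg (α := ℝ) k) (pow_nonneg h0 k))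
  linarith

lemma ser_compare {c : ℕ → ℝ} {B : ℝ} (hc : ∀ k, |c k| ≤ B) (l : ℕ)
    (hl : ∀ k, k < l → 0 ≤ c k) (hr : ∀ k, l < k → c k ≤ 0) {x y : ℝ} (h0 : 0 < x) (hxy : x ≤ y)
    (h1 : y < 1) (hneg : ser c x ≤ 0) : ser c y ≤ ser c x := by
  have hr1 : 1 ≤ y / x := by rw [le_div_iff₀ h0]; linarith
  have key : ser c y ≤ (y / x) ^ l * ser c x := by
    unfold ser
    rw [← tsum_mul_left]
    refine Summable.tsum_le_tsum (fun k => ?_) (ser_summable hc (h0.le.trans hxy) h1)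
      ((ser_summable hc h0.le (hxy.trans_lt h1)).mul_left _)
    have e1 : y ^ k = (y / x) ^ k * x ^ k := by rw [← mul_pow, div_mul_cancel₀ _ h0.ne']
    rw [e1]
    have hx := pow_pos h0 k
    rcases lt_trichotomy k l with h | h | h
    · have := pow_le_pow_right₀ hr1 h.le
      have h2 := mul_nonneg (hl k h) hx.le
      nlinarith
    · subst h; apply le_of_eq; ring
    · have := pow_le_pow_right₀ hr1 h.le
      have h2 := mul_nonneg (neg_nonneg.2 (hr k h)) hx.le
      nlinarith
  have : 1 ≤ (y / x) ^ l := one_le_pow₀ hr1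
  nlinarith

/-- difference quotient of powers -/
noncomputable def qd (x y : ℝ) : ℕ → ℝ
  | 0 => 0
  | k + 1 => y * qd x y k + x ^ k

lemma qd_mul (x y : ℝ) (k : ℕ) : (y - x) * qd x y k = y ^ k - x ^ k := by
  induction k with
  | zero => simp [qd]
  | succ k ih => rw [qd, mul_add, show (y - x) * (y * qd x y k) = y * ((y - x) * qd x y k) by ring, ih]; ring

lemma qd_nonneg {x y : ℝ} (hx : 0 < x) (hxy : x ≤ y) (k : ℕ) : 0 ≤ qd x y k := by
  induction k with
  | zero => simp [qd]
  | succ k ih => rw [qd]; have := hx.le.trans hxy; positivity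

lemma qd_lower {x y : ℝ} (hx : 0 < x) (hxy : x ≤ y) (k : ℕ) : k * x ^ k ≤ qd x y k * x := by
  induction k with
  | zero => simp [qd]
  | succ k ih =>
    rw [qd]; push_cast
    have h1 := qd_nonneg hx hxy k
    have : x * (qd x y k * x) ≤ y * (qd x y k * x) := mul_le_mul_of_nonneg_right hxy (by positivity)
    have h3 := mul_le_mul_of_nonneg_left ih hx.le
    rw [pow_succ]
    nlinarith

lemma qd_ratio {x y b : ℝ} (hx : 0 < x) (hxy : x ≤ y) (hb : y ≤ b) (k : ℕ) :
    k * qd x y (k + 1) ≤ (k + 1) * b * qd x y k := by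
  rw [qd]
  have h1 := qd_nonneg hx hxy k
  have h2 := qd_lower hx hxy k
  have h3 : 0 ≤ (b - x) * qd x y k := mul_nonneg (by linarith) h1
  have h4 : 0 ≤ (k : ℝ) * ((b - y) * qd x y k) :=
    mul_nonneg (Nat.cast_nonneg k) (mul_nonneg (by linarith) h1)
  nlinarith

noncomputable def rq (x y b : ℝ) (k : ℕ) : ℝ := qd x y k / (k * b ^ k)

lemma rq_anti {x y b : ℝ} (hx : 0 < x) (hxy : x ≤ y) (hb : y ≤ b) {k l : ℕ} (hk : 1 ≤ k)
    (hkl : k ≤ l) : rq x y b l ≤ rq x y b k := by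
  have hb0 : 0 < b := by linarith
  induction l, hkl using Nat.le_induction with
  | base => exact le_rfl
  | succ l hl ih =>
    refine le_trans ?_ ih
    unfold rq
    have hl0 : (0:ℝ) < l := by exact_mod_cast (lt_of_lt_of_le hk hl)
    rw [div_le_div_iff₀ (by positivity) (by positivity)]
    have := mul_le_mul_of_nonneg_right (qd_ratio hx hxy hb l) (pow_pos hb0 l).le
    push_cast
    rw [pow_succ]
    nlinarith

lemma ser_decrease {e : ℕ → ℝ} (he : ∀ k, |e k| ≤ 1) (K : ℕ) (hK : 1 ≤ K)
    (hl : ∀ k, 1 ≤ k → k < K → e k ≤ 0) (hr : ∀ k, K < k → 0 ≤ e k) {a b x y δ : ℝ} (hδ : 0 ≤ δ)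
    (ha : 0 < a) (hax : a ≤ x) (hxy : x ≤ y) (hyb : y ≤ b) (hb : b < 1)
    (hD : ∑' k : ℕ, (k : ℝ) * e k * b ^ k ≤ -δ) :
    ser e y ≤ ser e x - δ * a ^ K * (y - x) := by
  have hx : 0 < x := by linarith
  have hb0 : 0 < b := by linarith
  have hK0 : (0:ℝ) < K := by exact_mod_cast hK
  have sx := ser_summable he hx.le (by linarith : x < 1)
  have sy := ser_summable he (by linarith : 0 ≤ y) (by linarith : y < 1)
  have sb := ser_summable' he hb0.le hb
  set R := rq x y b K with hR
  have hRl : a ^ K ≤ R := by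
    rw [hR, rq, le_div_iff₀ (by positivity)]
    have h1 := qd_lower hx hxy K
    have h2 : a ^ K ≤ x ^ K := pow_le_pow_left₀ ha.le hax K
    have h3 : b ^ K ≤ 1 := pow_le_one₀ hb0.le hb.le
    have h4 := qd_nonneg hx hxy K
    calc a ^ K * (K * b ^ K) ≤ x ^ K * (K * 1) := by gcongr
      _ = K * x ^ K := by ring
      _ ≤ qd x y K * x := h1
      _ ≤ qd x y K * 1 := by gcongr; linarith
      _ = _ := mul_one _
  have key : ser e y - ser e x ≤ (y - x) * R * ∑' k : ℕ, (k : ℝ) * e k * b ^ k := by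
    unfold ser
    rw [← sy.tsum_sub sx, ← tsum_mul_left]
    refine Summable.tsum_le_tsum (fun k => ?_) (sy.sub sx) (sb.mul_left _)
    rw [← mul_sub, ← qd_mul]
    rcases Nat.eq_zero_or_pos k with h0 | h0
    · subst h0; simp [qd]
    have hk0 : (0:ℝ) < k := by exact_mod_cast h0
    have hq : qd x y k = rq x y b k * (k * b ^ k) := by
      rw [rq, div_mul_cancel₀]; positivity
    rw [hq]
    have hpos : 0 ≤ (y - x) * (k * b ^ k) := mul_nonneg (by linarith) (by positivity)
    suffices e k * rq x y b k ≤ e k * R by nlinarith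
    rcases lt_trichotomy k K with h | h | h
    · exact mul_le_mul_of_nonpos_left (rq_anti hx hxy hyb h0 h.le) (hl k h0 h)
    · rw [h]
    · exact mul_le_mul_of_nonneg_left (rq_anti hx hxy hyb hK h.le) (hr k h)
  have hyx : 0 ≤ y - x := by linarith
  have hR0 : 0 ≤ R := le_trans (by positivity) hRl
  have h5 : (y - x) * R * ∑' k : ℕ, (k : ℝ) * e k * b ^ k ≤ (y - x) * R * (-δ) :=
    mul_le_mul_of_nonneg_left hD (by positivity)
  have h6 : (y - x) * δ * a ^ K ≤ (y - x) * δ * R := mul_le_mul_of_nonneg_left hRl (by positivity)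
  nlinarith

lemma ser_transversal {e c : ℕ → ℝ} (he : ∀ k, |e k| ≤ 1) (hc : ∀ k, |c k| ≤ 1) (K : ℕ) (hK : 1 ≤ K)
    (h00 : c 0 = e 0)
    (hl : ∀ k, 1 ≤ k → k < K → e k ≤ 0) (hr : ∀ k, K < k → 0 ≤ e k)
    (hl' : ∀ k, 1 ≤ k → k < K → e k ≤ c k) (hr' : ∀ k, K < k → c k ≤ e k)
    {a b x y δ : ℝ} (hδ : 0 ≤ δ)
    (ha : 0 < a) (hax : a ≤ x) (hxy : x ≤ y) (hyb : y ≤ b) (hb : b < 1)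
    (hD : ∑' k : ℕ, (k : ℝ) * e k * b ^ k ≤ -δ) (hh : δ ≤ ser e b) (hf : ser c x ≤ δ) :
    ser c y ≤ ser c x - δ * a ^ K * (y - x) := by
  have hx : 0 < x := by linarith
  have h1 := ser_decrease he K hK hl hr hδ ha hax hxy hyb hb hD
  have h2 := ser_decrease he K hK hl hr hδ ha hax (hxy.trans hyb) le_rfl hb hD
  have h3 : 0 ≤ δ * a ^ K * (b - x) := mul_nonneg (by positivity) (by linarith)
  have hsub : ∀ z, 0 ≤ z → z < 1 → ser (fun k => c k - e k) z = ser c z - ser e z := by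
    intro z hz hz1
    unfold ser
    rw [← (ser_summable hc hz hz1).tsum_sub (ser_summable he hz hz1)]
    congr 1; ext k; ring
  have h4 := ser_compare (c := fun k => c k - e k) (B := 2)
    (fun k => (abs_sub _ _).trans (by linarith [hc k, he k])) K
    (fun k hk => by
      rcases Nat.eq_zero_or_pos k with h0 | h0
      · subst h0; simp [h00]
      · linarith [hl' k h0 hk])
    (fun k hk => by linarith [hr' k hk]) hx hxy (by linarith)
    (by rw [hsub x hx.le (by linarith)]; linarith)
  rw [hsub x hx.le (by linarith), hsub y (by linarith) (by linarith)] at h4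
  linarith

lemma ser_periodic {e : ℕ → ℝ} (he : ∀ k, |e k| ≤ 1) (N L : ℕ) (hL : 1 ≤ L)
    (hper : ∀ k, N ≤ k → e (k + L) = e k) {b : ℝ} (hb0 : 0 ≤ b) (hb : b < 1) :
    ser e b = ∑ k ∈ Finset.range N, e k * b ^ k
        + (∑ i ∈ Finset.range L, e (i + N) * b ^ (i + N)) / (1 - b ^ L) ∧
    ∑' k : ℕ, (k : ℝ) * e k * b ^ k = ∑ k ∈ Finset.range N, (k : ℝ) * e k * b ^ k
        + (∑ i ∈ Finset.range L, ((i + N : ℕ) : ℝ) * e (i + N) * b ^ (i + N)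
          + b ^ L * L * ((∑ i ∈ Finset.range L, e (i + N) * b ^ (i + N)) / (1 - b ^ L)))
            / (1 - b ^ L) := by
  have hz : 0 < 1 - b ^ L := by
    have := pow_lt_one₀ hb0 hb (by omega : L ≠ 0); linarith
  have s0 := ser_summable he hb0 hb
  have s1 := ser_summable' he hb0 hb
  have t0 := (summable_nat_add_iff N).2 s0
  have t1 := (summable_nat_add_iff N).2 s1
  have hper' : ∀ i, e (i + L + N) = e (i + N) := fun i => by
    rw [← hper (i + N) (by omega)]; congr 1; omega
  have A0 := t0.sum_add_tsum_nat_add L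
  have A1 := t1.sum_add_tsum_nat_add L
  have B0 : ∑' i, e (i + L + N) * b ^ (i + L + N) = b ^ L * ∑' i, e (i + N) * b ^ (i + N) := by
    rw [← tsum_mul_left]; congr 1; ext i; rw [hper']; ring
  have B1 : ∑' i : ℕ, ((i + L + N : ℕ) : ℝ) * e (i + L + N) * b ^ (i + L + N)
      = b ^ L * (∑' i : ℕ, ((i + N : ℕ) : ℝ) * e (i + N) * b ^ (i + N)
        + L * ∑' i, e (i + N) * b ^ (i + N)) := by
    rw [← tsum_mul_left (a := (L:ℝ)), ← t1.tsum_add (t0.mul_left _), ← tsum_mul_left]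
    congr 1; ext i; rw [hper']; push_cast; ring
  rw [B0] at A0
  rw [B1] at A1
  set T0 := ∑' i, e (i + N) * b ^ (i + N)
  set T1 := ∑' i : ℕ, ((i + N : ℕ) : ℝ) * e (i + N) * b ^ (i + N)
  have C0 : T0 = (∑ i ∈ Finset.range L, e (i + N) * b ^ (i + N)) / (1 - b ^ L) := by
    rw [eq_div_iff hz.ne']; linarith
  have C1 : T1 = (∑ i ∈ Finset.range L, ((i + N : ℕ) : ℝ) * e (i + N) * b ^ (i + N)
          + b ^ L * L * T0) / (1 - b ^ L) := by
    rw [eq_div_iff hz.ne']; linarith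
  constructor
  · unfold ser; rw [← s0.sum_add_tsum_nat_add N, ← C0]
  · rw [← s1.sum_add_tsum_nat_add N, ← C0, ← C1]

/-- uniform transversality on `[a,b]` of the power series supported on shifts of `pat` -/
def Transv (pat : ℕ → Bool) (a b : ℝ) : Prop :=
  ∃ δ : ℝ, 0 < δ ∧ ∀ n, pat n = true → ∀ c : ℕ → ℝ, c 0 = 1 → (∀ k, |c k| ≤ 1) →
    (∀ k, pat (n + k) = false → c k = 0) → ∀ x y, a ≤ x → x < y → y ≤ b → ser c x ≤ δ →
      ser c y ≤ ser c x - δ * (y - x)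

/-- comparison coefficients -/
noncomputable def estar (pat : ℕ → Bool) (n K : ℕ) (α : ℝ) (k : ℕ) : ℝ :=
  if k = 0 then 1 else if pat (n + k) then (if k < K then -1 else if k = K then α else 1) else 0

lemma estar_abs (pat : ℕ → Bool) (n K : ℕ) {α : ℝ} (hα : |α| ≤ 1) (k : ℕ) :
    |estar pat n K α k| ≤ 1 := by
  unfold estar; split_ifs <;> simp [hα]

lemma cert_transversal (pat : ℕ → Bool) (L : ℕ) (hL : 1 ≤ L) (hper : ∀ k, pat (k + L) = pat k)
    (i K : ℕ) (hK : 1 ≤ K) (hK6 : K ≤ 6) (α : ℝ) (hα : |α| ≤ 1) {a b : ℝ} (ha : 0 < a) (hb : b < 1)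
    (hb0 : 0 ≤ b)
    (hval : 1 / 200 ≤ ∑ k ∈ Finset.range (K + 1), estar pat i K α k * b ^ k
        + (∑ j ∈ Finset.range L, estar pat i K α (j + (K + 1)) * b ^ (j + (K + 1))) / (1 - b ^ L))
    (hder : ∑ k ∈ Finset.range (K + 1), (k : ℝ) * estar pat i K α k * b ^ k
        + (∑ j ∈ Finset.range L, ((j + (K + 1) : ℕ) : ℝ) * estar pat i K α (j + (K + 1)) * b ^ (j + (K + 1))
          + b ^ L * L * ((∑ j ∈ Finset.range L, estar pat i K α (j + (K + 1)) * b ^ (j + (K + 1))) / (1 - b ^ L)))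
            / (1 - b ^ L) ≤ - (1 / 200))
    (n : ℕ) (hn : n % L = i) (c : ℕ → ℝ) (hc0 : c 0 = 1) (hc : ∀ k, |c k| ≤ 1)
    (hcp : ∀ k, pat (n + k) = false → c k = 0) (x y : ℝ) (hx : a ≤ x) (hxy : x < y) (hy : y ≤ b)
    (hf : ser c x ≤ 1 / 200 * a ^ 6) : ser c y ≤ ser c x - 1 / 200 * a ^ 6 * (y - x) := by
  have hmod : ∀ k, pat (n + k) = pat (i + k) := by
    intro k
    have : ∀ m q, pat (q + L * m) = pat q := by
      intro m
      induction m with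
      | zero => intro q; simp
      | succ m ih => intro q; rw [← ih q, ← hper (q + L * m)]; congr 1; ring
    have h1 := this (n / L) (i + k)
    rw [← h1]; congr 1; rw [← hn]
    have := Nat.mod_add_div n L
    omega
  have he := estar_abs pat i K hα
  obtain ⟨e1, e2⟩ := ser_periodic he (K + 1) L hL (by
    intro k hk
    unfold estar
    rw [← add_assoc, hper, if_neg (by omega : ¬ k = 0), if_neg (by omega : ¬ k + L = 0),
      if_neg (by omega : ¬ k < K), if_neg (by omega : ¬ k = K),
      if_neg (by omega : ¬ k + L < K), if_neg (by omega : ¬ k + L = K)]) hb0 hb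
  rw [← e1] at hval
  rw [← e2] at hder
  have ha1 : a ≤ 1 := by linarith
  have hp6 : a ^ 6 ≤ a ^ K := pow_le_pow_of_le_one ha.le ha1 hK6
  have hp1 : a ^ 6 ≤ 1 := pow_le_one₀ ha.le ha1
  have := ser_transversal (e := estar pat i K α) (c := c) he hc K hK (by simp [estar, hc0])
    (by intro k h1 h2; unfold estar
        rw [if_neg (by omega), if_pos h2]; split_ifs <;> norm_num)
    (by intro k h1; unfold estar
        rw [if_neg (by omega : ¬ k = 0), if_neg (by omega : ¬ k < K), if_neg (by omega : ¬ k = K)]; split_ifs <;> norm_num)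
    (by intro k h1 h2; unfold estar
        rw [if_neg (by omega), if_pos h2]; split_ifs with h
        · exact (abs_le.1 (hc k)).1
        · rw [hcp k (by rw [hmod]; simpa using h)])
    (by intro k h1; unfold estar
        rw [if_neg (by omega : ¬ k = 0), if_neg (by omega : ¬ k < K), if_neg (by omega : ¬ k = K)]; split_ifs with h
        · exact (abs_le.1 (hc k)).2
        · rw [hcp k (by rw [hmod]; simpa using h)])
    (δ := 1 / 200) (by norm_num) ha hx hxy.le hy hb hder hval (by linarith)
  have h2 : 0 ≤ (a ^ K - a ^ 6) * (y - x) := mul_nonneg (by linarith) (by linarith)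
  linarith

def pat1 : ℕ → Bool := fun _ => true
def pat4 : ℕ → Bool := fun m => !(m % 4 == 1)
def pat3 : ℕ → Bool := fun m => !(m % 3 == 1)
def pat5 : ℕ → Bool := fun m => !(m % 5 == 1) && !(m % 5 == 3)

lemma transv1 {a : ℝ} (ha : 0 < a) : Transv pat1 a (63 / 100) := by
  refine ⟨1 / 200 * a ^ 6, by positivity, fun n hn c => ?_⟩
  exact cert_transversal pat1 1 le_rfl (fun _ => rfl) 0 4 (by norm_num) (by norm_num) (1 / 2)
    (by norm_num [abs_le]) ha (by norm_num) (by norm_num)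
    (by norm_num [Finset.sum_range_succ, estar, pat1])
    (by norm_num [Finset.sum_range_succ, estar, pat1]) n (Nat.mod_one n) c

lemma transv4 {a : ℝ} (ha : 0 < a) : Transv pat4 a (66 / 100) := by
  refine ⟨1 / 200 * a ^ 6, by positivity, fun n hn c => ?_⟩
  have hh : n % 4 = 0 ∨ n % 4 = 2 ∨ n % 4 = 3 := by
    simp [pat4] at hn; omega
  have hper : ∀ k, pat4 (k + 4) = pat4 k := fun k => by simp [pat4]
  rcases hh with h | h | h
  · exact cert_transversal pat4 4 (by norm_num) hper 0 4 (by norm_num) (by norm_num) (-4 / 10)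
      (by norm_num [abs_le]) ha (by norm_num) (by norm_num)
      (by norm_num [Finset.sum_range_succ, estar, pat4])
      (by norm_num [Finset.sum_range_succ, estar, pat4]) n h c
  · exact cert_transversal pat4 4 (by norm_num) hper 2 4 (by norm_num) (by norm_num) (-8 / 10)
      (by norm_num [abs_le]) ha (by norm_num) (by norm_num)
      (by norm_num [Finset.sum_range_succ, estar, pat4])
      (by norm_num [Finset.sum_range_succ, estar, pat4]) n h c
  · exact cert_transversal pat4 4 (by norm_num) hper 3 4 (by norm_num) (by norm_num) (-7 / 10)
      (by norm_num [abs_le]) ha (by norm_num) (by norm_num)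
      (by norm_num [Finset.sum_range_succ, estar, pat4])
      (by norm_num [Finset.sum_range_succ, estar, pat4]) n h c

lemma transv3 {a : ℝ} (ha : 0 < a) : Transv pat3 a (69 / 100) := by
  refine ⟨1 / 200 * a ^ 6, by positivity, fun n hn c => ?_⟩
  have hh : n % 3 = 0 ∨ n % 3 = 2 := by
    simp [pat3] at hn; omega
  have hper : ∀ k, pat3 (k + 3) = pat3 k := fun k => by simp [pat3]
  rcases hh with h | h
  · exact cert_transversal pat3 3 (by norm_num) hper 0 5 (by norm_num) (by norm_num) (-5 / 10)
      (by norm_num [abs_le]) ha (by norm_num) (by norm_num)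
      (by norm_num [Finset.sum_range_succ, estar, pat3])
      (by norm_num [Finset.sum_range_succ, estar, pat3]) n h c
  · exact cert_transversal pat3 3 (by norm_num) hper 2 4 (by norm_num) (by norm_num) (-7 / 10)
      (by norm_num [abs_le]) ha (by norm_num) (by norm_num)
      (by norm_num [Finset.sum_range_succ, estar, pat3])
      (by norm_num [Finset.sum_range_succ, estar, pat3]) n h c

lemma transv5 {a : ℝ} (ha : 0 < a) : Transv pat5 a (73 / 100) := by
  refine ⟨1 / 200 * a ^ 6, by positivity, fun n hn c => ?_⟩
  have hh : n % 5 = 0 ∨ n % 5 = 2 ∨ n % 5 = 4 := by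
    simp [pat5] at hn; omega
  have hper : ∀ k, pat5 (k + 5) = pat5 k := fun k => by simp [pat5]
  rcases hh with h | h | h
  · exact cert_transversal pat5 5 (by norm_num) hper 0 5 (by norm_num) (by norm_num) (-7 / 10)
      (by norm_num [abs_le]) ha (by norm_num) (by norm_num)
      (by norm_num [Finset.sum_range_succ, estar, pat5])
      (by norm_num [Finset.sum_range_succ, estar, pat5]) n h c
  · exact cert_transversal pat5 5 (by norm_num) hper 2 5 (by norm_num) (by norm_num) (-7 / 10)
      (by norm_num [abs_le]) ha (by norm_num) (by norm_num)
      (by norm_num [Finset.sum_range_succ, estar, pat5])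
      (by norm_num [Finset.sum_range_succ, estar, pat5]) n h c
  · exact cert_transversal pat5 5 (by norm_num) hper 4 6 (by norm_num) (by norm_num) (9 / 10)
      (by norm_num [abs_le]) ha (by norm_num) (by norm_num)
      (by norm_num [Finset.sum_range_succ, estar, pat5])
      (by norm_num [Finset.sum_range_succ, estar, pat5]) n h c

open MeasureTheory ProbabilityTheory Filter Topology

lemma exists_small_exponent {p τ : ℝ} (hp0 : 0 < p) (hp1 : p < 1) (hτ : 0 < τ)
    (h : p * Real.log p + (1 - p) * Real.log (1 - p) < Real.log τ) :
    ∃ s : ℝ, 0 < s ∧ s ≤ 1 ∧ p ^ (1 + s) + (1 - p) ^ (1 + s) < τ ^ s := by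
  have hq : 0 < 1 - p := by linarith
  have hd : HasDerivAt (fun s : ℝ => p ^ (1 + s) + (1 - p) ^ (1 + s) - τ ^ s)
      (p * Real.log p + (1 - p) * Real.log (1 - p) - Real.log τ) 0 := by
    have hid : HasDerivAt (fun s : ℝ => 1 + s) 1 0 := (hasDerivAt_id 0).const_add 1
    have h1 := hid.const_rpow hp0
    have h2 := hid.const_rpow hq
    have h3 := (hasDerivAt_id (0:ℝ)).const_rpow hτ
    have := (h1.add h2).sub h3
    refine this.congr_deriv ?_
    simp
    ring
  have hneg : p * Real.log p + (1 - p) * Real.log (1 - p) - Real.log τ < 0 := by linarith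
  have ht := hd.tendsto_slope_zero_right
  have ev := ht.eventually (gt_mem_nhds hneg)
  have ev2 : ∀ᶠ s : ℝ in 𝓝[>] 0, s ≤ 1 :=
    nhdsWithin_le_nhds (ge_mem_nhds (by norm_num : (0:ℝ) < 1))
  obtain ⟨s, ⟨h1, h2⟩, h3⟩ := ((ev.and ev2).and self_mem_nhdsWithin).exists
  refine ⟨s, h3, h2, ?_⟩
  have h3' : 0 < s := h3
  simp at h1
  have := (mul_neg_iff.1 h1)
  rcases this with ⟨_, h⟩ | ⟨h, _⟩
  · linarith
  · exact absurd h (not_lt.2 (by positivity))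

lemma summable_of_shift_ratio {u : ℕ → ℝ} (hu : ∀ n, 0 ≤ u n) (L M : ℕ) (hL : 1 ≤ L) {κ : ℝ}
    (hκ0 : 0 < κ) (hκ : κ < 1) (h : ∀ n, M ≤ n → u (n + L) ≤ κ * u n) : Summable u := by
  set k' : ℝ := κ ^ ((L : ℝ)⁻¹) with hk'
  have hL0 : (0:ℝ) < L := by exact_mod_cast hL
  have k0 : 0 < k' := Real.rpow_pos_of_pos hκ0 _
  have k1 : k' < 1 := Real.rpow_lt_one hκ0.le hκ (by positivity)
  have kL : k' ^ L = κ := Real.rpow_inv_natCast_pow hκ0.le (by omega)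
  set K := ∑ n ∈ Finset.range (M + L), u n / k' ^ n with hK
  have bound : ∀ n, u n ≤ K * k' ^ n := by
    intro n
    induction n using Nat.strong_induction_on with
    | _ n ih =>
      by_cases hn : n < M + L
      · rw [← div_le_iff₀ (pow_pos k0 n)]
        exact Finset.single_le_sum (f := fun n => u n / k' ^ n)
          (fun i _ => div_nonneg (hu i) (pow_pos k0 i).le) (Finset.mem_range.2 hn)
      · obtain ⟨m, rfl⟩ : ∃ m, n = m + L := ⟨n - L, by omega⟩
        have h1 := h m (by omega)
        have h2 := ih m (by omega)
        calc u (m + L) ≤ κ * u m := h1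
          _ ≤ κ * (K * k' ^ m) := by gcongr
          _ = K * k' ^ (m + L) := by rw [pow_add, kL]; ring
  exact Summable.of_nonneg_of_le hu bound ((summable_geometric_of_lt_one k0.le k1).mul_left K)

lemma summable_core (pat : ℕ → Bool) (L r : ℕ) (hL : 1 ≤ L) (hr : 1 ≤ r)
    (hcount : ∀ n, ((Finset.Ico n (n + L)).filter (fun k => pat k = true)).card = r)
    (w : ℕ → ℝ) (hw0 : ∀ k, 0 ≤ w k) (hw1 : ∀ k, w k ≤ 1) {p : ℝ} (hp0 : 0 < p) (hp1 : p < 1)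
    (hw : Tendsto w atTop (𝓝 p)) {a : ℝ} (ha : 0 < a)
    (hent : r * (p * Real.log p + (1 - p) * Real.log (1 - p)) < L * Real.log a) :
    ∃ s : ℝ, 0 < s ∧ s ≤ 1 ∧ Summable (fun n : ℕ => ((a⁻¹) ^ (n + 1)) ^ s *
      ∏ k ∈ Finset.range n, if pat k then (w k) ^ (1 + s) + (1 - w k) ^ (1 + s) else 1) := by
  have hr0 : (0:ℝ) < r := by exact_mod_cast hr
  obtain ⟨s, hs0, hs1, hs⟩ := exists_small_exponent (τ := a ^ ((L : ℝ) / r)) hp0 hp1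
    (Real.rpow_pos_of_pos ha _) (by
      rw [Real.log_rpow ha, div_mul_eq_mul_div, lt_div_iff₀ hr0]; linarith)
  refine ⟨s, hs0, hs1, ?_⟩
  obtain ⟨θ, hθ1, hθ2⟩ := exists_between hs
  have hθ0 : 0 < θ := lt_of_le_of_lt
    (add_nonneg (Real.rpow_nonneg hp0.le _) (Real.rpow_nonneg (by linarith) _)) hθ1
  have htend : Tendsto (fun k => (w k) ^ (1 + s) + (1 - w k) ^ (1 + s)) atTop
      (𝓝 (p ^ (1 + s) + (1 - p) ^ (1 + s))) :=
    (hw.rpow_const (Or.inr (by linarith))).add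
      ((tendsto_const_nhds.sub hw).rpow_const (Or.inr (by linarith)))
  obtain ⟨M, hM⟩ := eventually_atTop.1 (htend.eventually (gt_mem_nhds hθ1))
  have hc0 : ∀ k, 0 ≤ (if pat k then (w k) ^ (1 + s) + (1 - w k) ^ (1 + s) else (1:ℝ)) := by
    intro k
    split_ifs
    · exact add_nonneg (Real.rpow_nonneg (hw0 k) _) (Real.rpow_nonneg (by linarith [hw1 k]) _)
    · norm_num
  have hai : 0 < a⁻¹ := inv_pos.2 ha
  have hpow : ∀ m : ℕ, ((a⁻¹) ^ m) ^ s = ((a⁻¹) ^ s) ^ m := fun m => by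
    rw [← Real.rpow_natCast, ← Real.rpow_natCast, ← Real.rpow_mul hai.le, ← Real.rpow_mul hai.le,
      mul_comm]
  have hA : 0 < (a⁻¹) ^ s := Real.rpow_pos_of_pos hai _
  have hκ : ((a⁻¹) ^ s) ^ L * θ ^ r < 1 := by
    have h1 : θ ^ r < ((a ^ ((L : ℝ) / r)) ^ s) ^ r := pow_lt_pow_left₀ hθ2 hθ0.le (by omega)
    have h2 : ((a ^ ((L : ℝ) / r)) ^ s) ^ r = (a ^ s) ^ L := by
      rw [← Real.rpow_natCast, ← Real.rpow_natCast, ← Real.rpow_mul ha.le, ← Real.rpow_mul ha.le,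
        ← Real.rpow_mul ha.le]
      congr 1; field_simp
    have h3 : ((a⁻¹) ^ s) ^ L * (a ^ s) ^ L = 1 := by
      rw [← mul_pow, ← Real.mul_rpow hai.le ha.le, inv_mul_cancel₀ ha.ne', Real.one_rpow, one_pow]
    rw [h2] at h1
    calc _ < ((a⁻¹) ^ s) ^ L * (a ^ s) ^ L := mul_lt_mul_of_pos_left h1 (pow_pos hA L)
      _ = 1 := h3
  refine summable_of_shift_ratio (fun n => mul_nonneg (Real.rpow_nonneg (by positivity) _)
    (Finset.prod_nonneg fun k _ => hc0 k)) L M hL (by positivity) hκ (fun n hn => ?_)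
  rw [← Finset.prod_range_mul_prod_Ico _ (Nat.le_add_right n L), hpow, hpow]
  have hprod : ∏ k ∈ Finset.Ico n (n + L),
      (if pat k then (w k) ^ (1 + s) + (1 - w k) ^ (1 + s) else (1:ℝ)) ≤ θ ^ r := by
    rw [← Finset.prod_filter, ← hcount n]
    rw [← Finset.prod_const]
    refine Finset.prod_le_prod (fun k hk => ?_) (fun k hk => ?_)
    · have := hc0 k
      rwa [if_pos (Finset.mem_filter.1 hk).2] at this
    · exact (hM k (hn.trans (Finset.mem_Ico.1 (Finset.mem_filter.1 hk).1).1)).le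
  have hpre : 0 ≤ ((a⁻¹) ^ s) ^ (n + 1) * ∏ k ∈ Finset.range n,
      (if pat k then (w k) ^ (1 + s) + (1 - w k) ^ (1 + s) else (1:ℝ)) :=
    mul_nonneg (by positivity) (Finset.prod_nonneg fun k _ => hc0 k)
  have h5 := mul_le_mul_of_nonneg_left hprod (mul_nonneg hpre (pow_pos hA L).le)
  calc _ = _ := ?_
    _ ≤ _ := h5
    _ = _ := ?_
  · rw [show n + L + 1 = (n + 1) + L by ring, pow_add]; ring
  · ring

/-- the random series restricted to indices in `pat` -/
noncomputable def Psi {Ω : Type*} (pat : ℕ → Bool) (X : ℕ → Ω → Bool) (lam : ℝ) (ω : Ω) : ℝ :=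
  ∑' k : ℕ, if (pat k && X k ω) then lam ^ (k + 1) else 0

/-- everywhere measurable version -/
noncomputable def PsiE {Ω : Type*} (pat : ℕ → Bool) (X : ℕ → Ω → Bool) (lam : ℝ) (ω : Ω) : ℝ :=
  (∑' k : ℕ, ENNReal.ofReal (if (pat k && X k ω) then lam ^ (k + 1) else 0)).toReal

lemma Psi_summable {Ω : Type*} (pat : ℕ → Bool) (X : ℕ → Ω → Bool) {lam : ℝ} (h0 : 0 ≤ lam)
    (h1 : lam < 1) (ω : Ω) : Summable (fun k : ℕ => if (pat k && X k ω) then lam ^ (k + 1) else 0) := by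
  refine Summable.of_nonneg_of_le (fun k => ?_) (fun k => ?_)
    ((summable_geometric_of_lt_one h0 h1).mul_left lam)
  · split_ifs <;> positivity
  · split_ifs
    · rw [pow_succ']
    · positivity

lemma PsiE_eq {Ω : Type*} (pat : ℕ → Bool) (X : ℕ → Ω → Bool) {lam : ℝ} (h0 : 0 ≤ lam)
    (h1 : lam < 1) (ω : Ω) : PsiE pat X lam ω = Psi pat X lam ω := by
  unfold PsiE Psi
  have hn : ∀ k : ℕ, 0 ≤ (if (pat k && X k ω) then lam ^ (k + 1) else 0) := by
    intro k; split_ifs <;> positivity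
  rw [← ENNReal.ofReal_tsum_of_nonneg hn (Psi_summable pat X h0 h1 ω),
    ENNReal.toReal_ofReal (tsum_nonneg hn)]

lemma PsiE_measurable {Ω : Type*} [MeasurableSpace Ω] (pat : ℕ → Bool) (X : ℕ → Ω → Bool)
    (hX : ∀ k, Measurable (X k)) : Measurable (fun z : ℝ × Ω => PsiE pat X z.1 z.2) := by
  unfold PsiE
  refine ENNReal.measurable_toReal.comp (Measurable.tsum fun k => ?_)
  refine ENNReal.measurable_ofReal.comp (Measurable.ite ?_ (by fun_prop) measurable_const)
  have : Measurable (fun z : ℝ × Ω => pat k && X k z.2) :=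
    (measurable_of_finite (fun b : Bool => pat k && b)).comp ((hX k).comp measurable_snd)
  exact this (measurableSet_singleton true)

lemma ac_of_frequently {Ω : Type*} [MeasurableSpace Ω] (μ : Measure Ω) [IsProbabilityMeasure μ]
    (Φ : Ω → ℝ) (hΦ : Measurable Φ)
    (h : ∀ᵐ ω ∂μ, ∃ M : ℕ, ∃ᶠ m : ℕ in atTop,
      μ {ω' | |Φ ω - Φ ω'| ≤ 1 / ((m : ℝ) + 1)} ≤ M * ENNReal.ofReal (1 / ((m : ℝ) + 1))) :
    μ.map Φ ≪ volume := by
  have : IsProbabilityMeasure (μ.map Φ) := Measure.isProbabilityMeasure_map hΦ.aemeasurable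
  refine Measure.AbsolutelyContinuous.mk (fun N hN hN0 => ?_)
  rw [Measure.map_apply hΦ hN]
  set ν := μ.map Φ with hν
  set S : ℕ → Set ℝ := fun M => {x | ∃ᶠ m : ℕ in atTop,
      ν (Metric.closedBall x (1 / ((m : ℝ) + 1))) ≤ M * ENNReal.ofReal (1 / ((m : ℝ) + 1))} with hS
  have hS0 : ∀ M, ν (N ∩ S M) = 0 := by
    intro M
    have := (Besicovitch.vitaliFamily ν).measure_le_of_frequently_le (ρ := ν) ((M : NNReal) • volume)
      Measure.AbsolutelyContinuous.rfl (N ∩ S M) (by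
        rintro x ⟨_, hx⟩
        have ht : Tendsto (fun m : ℕ => (1 / ((m : ℝ) + 1))) atTop (𝓝[>] 0) :=
          tendsto_nhdsWithin_iff.2 ⟨tendsto_one_div_add_atTop_nhds_zero_nat,
            Eventually.of_forall fun m => by simp only [Set.mem_Ioi]; positivity⟩
        refine ((Besicovitch.tendsto_filterAt ν x).comp ht).frequently (hx.mono fun m hm => ?_)
        simp only [Function.comp, Measure.smul_apply, ENNReal.smul_def, smul_eq_mul, Real.volume_closedBall, ENNReal.coe_natCast]
        refine hm.trans ?_
        gcongr
        have : (0:ℝ) ≤ 1 / ((m : ℝ) + 1) := by positivity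
        linarith)
    refine le_antisymm (this.trans ?_) bot_le
    simp only [Measure.smul_apply, ENNReal.smul_def, smul_eq_mul]
    rw [measure_mono_null Set.inter_subset_left hN0, mul_zero]
  have hcov : Φ ⁻¹' N ⊆ (⋃ M, Φ ⁻¹' (N ∩ S M)) ∪ {ω | ¬ ∃ M : ℕ, ∃ᶠ m : ℕ in atTop,
      μ {ω' | |Φ ω - Φ ω'| ≤ 1 / ((m : ℝ) + 1)} ≤ M * ENNReal.ofReal (1 / ((m : ℝ) + 1))} := by
    intro ω hω
    by_cases hb : ∃ M : ℕ, ∃ᶠ m : ℕ in atTop,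
      μ {ω' | |Φ ω - Φ ω'| ≤ 1 / ((m : ℝ) + 1)} ≤ M * ENNReal.ofReal (1 / ((m : ℝ) + 1))
    · left
      obtain ⟨M, hM⟩ := hb
      refine Set.mem_iUnion.2 ⟨M, hω, hM.mono fun m hm => ?_⟩
      rw [hν, Measure.map_apply hΦ Metric.isClosed_closedBall.measurableSet]
      convert hm using 2
      ext ω'
      simp [Real.dist_eq, abs_sub_comm]
    · right; exact hb
  refine measure_mono_null hcov (measure_union_null (measure_iUnion_null fun M => ?_) h)
  exact le_antisymm ((Measure.le_map_apply hΦ.aemeasurable _).trans (hS0 M).le) bot_le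

lemma Psi_sub_eq {Ω : Type*} (pat : ℕ → Bool) (X : ℕ → Ω → Bool) {lam : ℝ} (h0 : 0 ≤ lam)
    (h1 : lam < 1) (ω ω' : Ω) (n : ℕ) (hagree : ∀ k < n, pat k = true → X k ω' = X k ω) :
    Psi pat X lam ω - Psi pat X lam ω' = lam ^ (n + 1) * ser (fun k =>
      if pat (n + k) then ((if X (n + k) ω then 1 else 0) - (if X (n + k) ω' then 1 else 0) : ℝ)
        else 0) lam := by
  unfold Psi ser
  have s1 := Psi_summable pat X h0 h1 ω
  have s2 := Psi_summable pat X h0 h1 ω'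
  rw [← s1.tsum_sub s2, ← (s1.sub s2).sum_add_tsum_nat_add n, Finset.sum_eq_zero, zero_add,
    ← tsum_mul_left]
  · congr 1; ext k
    rw [add_comm k n]
    have e1 : lam ^ (n + k + 1) = lam ^ (n + 1) * lam ^ k := by ring
    by_cases hp : pat (n + k) = true <;> by_cases hx : X (n + k) ω = true <;>
      by_cases hy : X (n + k) ω' = true <;> simp [hp, hx, hy, e1]
  · intro k hk
    have := hagree k (Finset.mem_range.1 hk)
    cases hp : pat k
    · simp
    · simp [this hp]

lemma vol_bound {Ω : Type*} (pat : ℕ → Bool) (X : ℕ → Ω → Bool) {a b δ : ℝ} (ha : 0 < a)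
    (hb : b < 1) (hδ : 0 < δ)
    (hT : ∀ n, pat n = true → ∀ c : ℕ → ℝ, c 0 = 1 → (∀ k, |c k| ≤ 1) →
    (∀ k, pat (n + k) = false → c k = 0) → ∀ x y, a ≤ x → x < y → y ≤ b → ser c x ≤ δ →
      ser c y ≤ ser c x - δ * (y - x))
    (ω ω' : Ω) (n : ℕ) (hn : pat n = true) (h1 : X n ω = true) (h2 : X n ω' = false)
    (hagree : ∀ k < n, pat k = true → X k ω' = X k ω) {r : ℝ} (hr : 0 < r) :
    volume {lam | lam ∈ Set.Icc a b ∧ |Psi pat X lam ω - Psi pat X lam ω'| ≤ r}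
      ≤ ENNReal.ofReal (2 / δ * r * (a⁻¹) ^ (n + 1)) := by
  set c : ℕ → ℝ := fun k =>
      if pat (n + k) then ((if X (n + k) ω then 1 else 0) - (if X (n + k) ω' then 1 else 0) : ℝ)
        else 0 with hc
  have hc0 : c 0 = 1 := by simp [hc, hn, h1, h2]
  have hc1 : ∀ k, |c k| ≤ 1 := by
    intro k; simp only [hc]; split_ifs <;> norm_num
  have hcp : ∀ k, pat (n + k) = false → c k = 0 := by
    intro k hk; simp [hc, hk]
  set ρ := r * (a⁻¹) ^ (n + 1) with hρ
  have hai : 0 < a⁻¹ := inv_pos.2 ha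
  have hρ0 : 0 < ρ := by positivity
  have hser : ∀ lam, lam ∈ Set.Icc a b → |Psi pat X lam ω - Psi pat X lam ω'| ≤ r →
      |ser c lam| ≤ ρ := by
    intro lam hl hh
    have hl0 : 0 < lam := lt_of_lt_of_le ha hl.1
    rw [Psi_sub_eq pat X hl0.le (lt_of_le_of_lt hl.2 hb) ω ω' n hagree, abs_mul,
      abs_of_pos (pow_pos hl0 _)] at hh
    have h3 : a ^ (n + 1) ≤ lam ^ (n + 1) := pow_le_pow_left₀ ha.le hl.1 _
    have h4 : a ^ (n + 1) * |ser c lam| ≤ r :=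
      (mul_le_mul_of_nonneg_right h3 (abs_nonneg _)).trans hh
    rw [hρ, inv_pow, ← div_eq_mul_inv, le_div_iff₀ (by positivity)]
    linarith
  have key : ∀ x y, x ∈ Set.Icc a b → y ∈ Set.Icc a b → |ser c x| ≤ ρ → |ser c y| ≤ ρ → x < y →
      y - x ≤ 2 / δ * ρ := by
    intro x y hx hy hsx hsy hxy
    rw [div_mul_eq_mul_div, le_div_iff₀ hδ]
    by_cases hd : ρ ≤ δ
    · have := hT n hn c hc0 hc1 hcp x y hx.1 hxy hy.2 ((le_abs_self _).trans (hsx.trans hd))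
      have h5 := (abs_le.1 hsx).2
      have h6 := (abs_le.1 hsy).1
      linarith
    · push Not at hd
      have : y - x ≤ 1 := by linarith [hx.1, hy.2]
      nlinarith
  refine (Real.volume_le_diam _).trans ?_
  rw [show 2 / δ * r * (a⁻¹) ^ (n + 1) = 2 / δ * ρ by rw [hρ]; ring]
  refine Metric.ediam_le_of_forall_dist_le ?_
  rintro x ⟨hx, hx'⟩ y ⟨hy, hy'⟩
  have hsx := hser x hx hx'
  have hsy := hser y hy hy'
  rw [Real.dist_eq]
  rcases lt_trichotomy x y with h | h | h
  · rw [abs_sub_comm, abs_of_pos (by linarith)]; exact key x y hx hy hsx hsy h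
  · subst h; simp; positivity
  · rw [abs_of_pos (by linarith)]; exact key y x hy hx hsy hsx h

/-- points agreeing with `ω` before `n` -/
def Agree {Ω : Type*} (pat : ℕ → Bool) (X : ℕ → Ω → Bool) (n : ℕ) (ω : Ω) : Set Ω :=
  {ω' | ∀ k ∈ Finset.range n, pat k = true → X k ω' = X k ω}

lemma Agree_eq {Ω : Type*} (pat : ℕ → Bool) (X : ℕ → Ω → Bool) (n : ℕ) (ω : Ω) :
    Agree pat X n ω = ⋂ k ∈ Finset.range n, X k ⁻¹' {b | pat k = true → b = X k ω} := by
  ext ω'; simp [Agree]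

lemma Agree_measurable {Ω : Type*} [MeasurableSpace Ω] (pat : ℕ → Bool) (X : ℕ → Ω → Bool)
    (hX : ∀ k, Measurable (X k)) (n : ℕ) (ω : Ω) : MeasurableSet (Agree pat X n ω) := by
  rw [Agree_eq]
  exact Finset.measurableSet_biInter _ fun k _ => hX k (Set.toFinite _).measurableSet

lemma vol_bound_sum {Ω : Type*} (pat : ℕ → Bool) (X : ℕ → Ω → Bool) {a b δ : ℝ} (ha : 0 < a)
    (ha1 : a ≤ 1) (hb : b < 1) (hδ : 0 < δ)
    (hT : ∀ n, pat n = true → ∀ c : ℕ → ℝ, c 0 = 1 → (∀ k, |c k| ≤ 1) →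
    (∀ k, pat (n + k) = false → c k = 0) → ∀ x y, a ≤ x → x < y → y ≤ b → ser c x ≤ δ →
      ser c y ≤ ser c x - δ * (y - x))
    (ω ω' : Ω) {r : ℝ} (hr : 0 < r) :
    volume {lam | lam ∈ Set.Icc a b ∧ |Psi pat X lam ω - Psi pat X lam ω'| ≤ r}
      ≤ ∑' n, ENNReal.ofReal (2 / δ * r * (a⁻¹) ^ (n + 1)) *
          (Agree pat X n ω).indicator (fun _ => 1) ω' := by
  have hai : 1 ≤ a⁻¹ := (one_le_inv₀ ha).2 ha1
  by_cases hex : ∃ k, pat k = true ∧ X k ω' ≠ X k ω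
  · classical
    set n := Nat.find hex with hn
    obtain ⟨hpn, hne⟩ := Nat.find_spec hex
    have hmin : ∀ k < n, pat k = true → X k ω' = X k ω := by
      intro k hk hp
      by_contra hcon
      exact Nat.find_min hex hk ⟨hp, hcon⟩
    have hmem : ω' ∈ Agree pat X n ω := fun k hk hp => hmin k (Finset.mem_range.1 hk) hp
    refine le_trans ?_ (ENNReal.le_tsum n)
    rw [Set.indicator_of_mem hmem, mul_one]
    cases h1 : X n ω <;> cases h2 : X n ω'
    · exact absurd (h2.trans h1.symm) hne
    · have := vol_bound pat X ha hb hδ hT ω' ω n hpn h2 h1 (fun k hk hp => (hmin k hk hp).symm) hr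
      simpa only [abs_sub_comm] using this
    · exact vol_bound pat X ha hb hδ hT ω ω' n hpn h1 h2 hmin hr
    · exact absurd (h2.trans h1.symm) hne
  · push Not at hex
    have hmem : ∀ n, ω' ∈ Agree pat X n ω := fun n k _ hp => hex k hp
    refine le_trans le_top ?_
    rw [top_le_iff, ← top_le_iff]
    have hpos : ENNReal.ofReal (2 / δ * r) ≠ 0 := by
      rw [Ne, ENNReal.ofReal_eq_zero, not_le]; positivity
    rw [← ENNReal.tsum_const_eq_top_of_ne_zero (α := ℕ) hpos]
    refine ENNReal.tsum_le_tsum fun n => ?_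
    rw [Set.indicator_of_mem (hmem n), mul_one]
    apply ENNReal.ofReal_le_ofReal
    have h3 : 1 ≤ (a⁻¹) ^ (n + 1) := one_le_pow₀ hai
    have : 0 ≤ 2 / δ * r := by positivity
    nlinarith

lemma tsum_lt_top_of_rpow {u : ℕ → ENNReal} {s : ℝ} (hs0 : 0 < s) (hs1 : s ≤ 1)
    (h : ∑' n, u n ^ s ≠ ⊤) : ∑' n, u n ≠ ⊤ := by
  have hlt : ∀ n, u n ≠ ⊤ := by
    intro n hn
    apply h
    apply top_unique
    calc (⊤ : ENNReal) = u n ^ s := by rw [hn, ENNReal.top_rpow_of_pos hs0]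
      _ ≤ _ := ENNReal.le_tsum n
  have ht := ENNReal.tendsto_atTop_zero_of_tsum_ne_top h
  have hev : ∀ᶠ n in atTop, u n ^ s < 1 := (tendsto_order.1 ht).2 1 one_pos
  obtain ⟨N, hN⟩ := eventually_atTop.1 hev
  have hle : ∀ n, N ≤ n → u n ≤ u n ^ s := by
    intro n hn
    have h1 : u n ≤ 1 := by
      by_contra hc
      push Not at hc
      have := ENNReal.one_lt_rpow hc hs0
      exact absurd (hN n hn) (not_lt.2 this.le)
    calc u n = u n ^ (1:ℝ) := (ENNReal.rpow_one _).symm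
      _ ≤ u n ^ s := ENNReal.rpow_le_rpow_of_exponent_ge h1 hs1
  rw [← ENNReal.summable.sum_add_tsum_nat_add' (k := N)]
  refine ENNReal.add_ne_top.2 ⟨(ENNReal.sum_lt_top.2 fun n _ => (hlt n).lt_top).ne, ?_⟩
  refine ne_top_of_le_ne_top h ?_
  calc ∑' n, u (n + N) ≤ ∑' n, u (n + N) ^ s := ENNReal.tsum_le_tsum fun n => hle _ (by omega)
    _ ≤ ∑' n, u n ^ s := ENNReal.tsum_comp_le_tsum_of_injective (add_left_injective N) _

lemma measure_Agree {Ω : Type*} [MeasurableSpace Ω] {μ : Measure Ω} (pat : ℕ → Bool)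
    (X : ℕ → Ω → Bool) (hI : iIndepFun X μ) (n : ℕ) (ω : Ω) :
    μ (Agree pat X n ω) = ∏ k ∈ Finset.range n, if pat k then μ (X k ⁻¹' {X k ω}) else 1 := by
  have := hI.isProbabilityMeasure
  rw [Agree_eq, hI.measure_inter_preimage_eq_mul (Finset.range n)
    (fun i _ => (Set.toFinite _).measurableSet)]
  refine Finset.prod_congr rfl fun k _ => ?_
  cases hp : pat k
  · have : {b : Bool | false = true → b = X k ω} = Set.univ := by ext; simp
    rw [this, Set.preimage_univ, measure_univ]; rfl
  · simp only [forall_const, if_true]; rfl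

lemma lintegral_g {Ω : Type*} [MeasurableSpace Ω] {μ : Measure Ω}
    (Y : Ω → Bool) (hY : Measurable Y) (w s : ℝ) (hw0 : 0 ≤ w) (hw1 : w ≤ 1) (hs : 0 < s)
    (h0 : μ (Y ⁻¹' {false}) = ENNReal.ofReal w) (h1 : μ (Y ⁻¹' {true}) = ENNReal.ofReal (1 - w)) :
    ∫⁻ ω, (μ (Y ⁻¹' {Y ω})) ^ s ∂μ = ENNReal.ofReal (w ^ (1 + s) + (1 - w) ^ (1 + s)) := by
  have h1w : 0 ≤ 1 - w := by linarith
  have : ∫⁻ ω, (μ (Y ⁻¹' {Y ω})) ^ s ∂μ = ∫⁻ b, (μ (Y ⁻¹' {b})) ^ s ∂(μ.map Y) := by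
    rw [lintegral_map (measurable_of_finite _) hY]
  rw [this, lintegral_fintype]
  simp only [Fintype.sum_bool]
  rw [Measure.map_apply hY (measurableSet_singleton _), Measure.map_apply hY (measurableSet_singleton _),
    h0, h1, ENNReal.ofReal_rpow_of_nonneg hw0 hs.le, ENNReal.ofReal_rpow_of_nonneg h1w hs.le,
    ← ENNReal.ofReal_mul (by positivity), ← ENNReal.ofReal_mul (by positivity),
    ← ENNReal.ofReal_add (by positivity) (by positivity)]
  rw [add_comm 1 s, Real.rpow_add_one' hw0 (by linarith), Real.rpow_add_one' h1w (by linarith), add_comm]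

lemma G_finite {Ω : Type*} [MeasurableSpace Ω] {μ : Measure Ω} (pat : ℕ → Bool)
    (X : ℕ → Ω → Bool) (hX : ∀ k, Measurable (X k)) (hI : iIndepFun X μ)
    (w : ℕ → ℝ) (hw0 : ∀ k, 0 ≤ w k) (hw1 : ∀ k, w k ≤ 1)
    (hf : ∀ k, μ (X k ⁻¹' {false}) = ENNReal.ofReal (w k))
    (ht : ∀ k, μ (X k ⁻¹' {true}) = ENNReal.ofReal (1 - w k))
    {a s : ℝ} (ha : 0 < a) (hs0 : 0 < s) (hs1 : s ≤ 1)
    (hS : Summable (fun n : ℕ => ((a⁻¹) ^ (n + 1)) ^ s *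
      ∏ k ∈ Finset.range n, if pat k then (w k) ^ (1 + s) + (1 - w k) ^ (1 + s) else 1)) :
    ∀ᵐ ω ∂μ, ∑' n, ENNReal.ofReal ((a⁻¹) ^ (n + 1)) * μ (Agree pat X n ω) ≠ ⊤ := by
  have hprob := hI.isProbabilityMeasure
  set g : ℕ → Bool → ENNReal := fun k b => if pat k then μ (X k ⁻¹' {b}) ^ s else 1 with hg
  have hgm : ∀ k, Measurable (fun ω => g k (X k ω)) := fun k =>
    (measurable_of_finite (g k)).comp (hX k)
  have key : ∀ n, ∫⁻ ω, (ENNReal.ofReal ((a⁻¹) ^ (n + 1)) * μ (Agree pat X n ω)) ^ s ∂μ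
      = ENNReal.ofReal (((a⁻¹) ^ (n + 1)) ^ s *
      ∏ k ∈ Finset.range n, if pat k then (w k) ^ (1 + s) + (1 - w k) ^ (1 + s) else 1) := by
    intro n
    have e : ∀ ω, (ENNReal.ofReal ((a⁻¹) ^ (n + 1)) * μ (Agree pat X n ω)) ^ s
        = ENNReal.ofReal (((a⁻¹) ^ (n + 1)) ^ s) * ∏ k ∈ Finset.range n, g k (X k ω) := by
      intro ω
      rw [ENNReal.mul_rpow_of_nonneg _ _ hs0.le, ENNReal.ofReal_rpow_of_nonneg (by positivity) hs0.le,
        measure_Agree pat X hI, ← ENNReal.prod_rpow_of_nonneg hs0.le]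
      congr 1
      refine Finset.prod_congr rfl fun k _ => ?_
      simp only [hg]; split_ifs <;> simp
    simp only [e]
    rw [lintegral_const_mul _ (Finset.measurable_prod _ fun k _ => hgm k),
      lintegral_prod_eq_prod_lintegral_of_indepFun (Finset.range n) (fun k ω => g k (X k ω))
        (hI.comp g fun k => measurable_of_finite _) hgm,
      ENNReal.ofReal_mul (by positivity), ENNReal.ofReal_prod_of_nonneg]
    · congr 1
      refine Finset.prod_congr rfl fun k _ => ?_
      simp only [hg]
      cases hp : pat k
      · simp
      · simp only [if_true]
        exact lintegral_g (X k) (hX k) (w k) s (hw0 k) (hw1 k) hs0 (hf k) (ht k)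
    · intro k _
      have := hw0 k
      have : 0 ≤ 1 - w k := by linarith [hw1 k]
      split_ifs <;> positivity
  have hmA : ∀ n, Measurable (fun ω => μ (Agree pat X n ω)) := by
    intro n
    simp only [measure_Agree pat X hI]
    refine Finset.measurable_prod _ fun k _ => ?_
    exact (measurable_of_finite (fun b => if pat k then μ (X k ⁻¹' {b}) else 1)).comp (hX k)
  have hm : ∀ n, Measurable
      (fun ω => (ENNReal.ofReal ((a⁻¹) ^ (n + 1)) * μ (Agree pat X n ω)) ^ s) := fun n =>
    ((hmA n).const_mul _).pow_const s
  have hInt : ∫⁻ ω, ∑' n, (ENNReal.ofReal ((a⁻¹) ^ (n + 1)) * μ (Agree pat X n ω)) ^ s ∂μ ≠ ⊤ := by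
    rw [lintegral_tsum fun n => (hm n).aemeasurable]
    simp only [key]
    exact hS.tsum_ofReal_ne_top
  filter_upwards [ae_lt_top (Measurable.tsum hm) hInt] with ω hω
  exact tsum_lt_top_of_rpow hs0 hs1 hω.ne

lemma measurableSet_close {α : Type*} [MeasurableSpace α] {f g : α → ℝ} (hf : Measurable f)
    (hg : Measurable g) (r : ℝ) : MeasurableSet {z | |f z - g z| ≤ r} :=
  measurableSet_le (continuous_abs.measurable.comp (hf.sub hg)) measurable_const

set_option maxHeartbeats 1000000 in
lemma core_ae {Ω : Type*} [MeasurableSpace Ω] {μ : Measure Ω} (pat : ℕ → Bool)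
    (X : ℕ → Ω → Bool) (hX : ∀ k, Measurable (X k)) (hI : iIndepFun X μ)
    {a b : ℝ} (ha : 0 < a) (ha1 : a ≤ 1) (hb : b < 1) (hT : Transv pat a b)
    (hG : ∀ᵐ ω ∂μ, ∑' n, ENNReal.ofReal ((a⁻¹) ^ (n + 1)) * μ (Agree pat X n ω) ≠ ⊤) :
    ∀ᵐ lam ∂(volume.restrict (Set.Icc a b)), μ.map (Psi pat X lam) ≪ volume := by
  have hprob := hI.isProbabilityMeasure
  obtain ⟨δ, hδ, hT⟩ := hT
  set ρ := volume.restrict (Set.Icc a b) with hρ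
  have hPm := PsiE_measurable pat X hX
  set S : ℕ → Set ((ℝ × Ω) × Ω) := fun m =>
    {z | |PsiE pat X z.1.1 z.1.2 - PsiE pat X z.1.1 z.2| ≤ 1 / ((m : ℝ) + 1)} with hS
  have hSm : ∀ m, MeasurableSet (S m) := by
    intro m
    have h1 : Measurable (fun z : (ℝ × Ω) × Ω => PsiE pat X z.1.1 z.1.2) := hPm.comp measurable_fst
    have h2 : Measurable (fun z : (ℝ × Ω) × Ω => PsiE pat X z.1.1 z.2) :=
      hPm.comp ((measurable_fst.comp measurable_fst).prodMk measurable_snd)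
    exact measurableSet_close h1 h2 _
  set F : ℕ → ℝ × Ω → ENNReal := fun m z => ((m : ENNReal) + 1) * μ (Prod.mk z ⁻¹' S m) with hF
  have hFm : ∀ m, Measurable (F m) := fun m =>
    (measurable_measure_prodMk_left (hSm m)).const_mul _
  have hLm : Measurable (fun z => liminf (fun m => F m z) atTop) := Measurable.liminf hFm
  have hbound : ∀ ω m, ∫⁻ lam, F m (lam, ω) ∂ρ ≤ ENNReal.ofReal (2 / δ) *
      ∑' n, ENNReal.ofReal ((a⁻¹) ^ (n + 1)) * μ (Agree pat X n ω) := by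
    intro ω m
    have hm0 : (0:ℝ) < 1 / ((m : ℝ) + 1) := by positivity
    set T : Set (ℝ × Ω) := {z | |PsiE pat X z.1 ω - PsiE pat X z.1 z.2| ≤ 1 / ((m : ℝ) + 1)} with hTd
    have hTm : MeasurableSet T := by
      have h1 : Measurable (fun z : ℝ × Ω => PsiE pat X z.1 ω) :=
        hPm.comp (measurable_fst.prodMk measurable_const)
      exact measurableSet_close h1 hPm _
    have e1 : ∫⁻ lam, F m (lam, ω) ∂ρ = ((m : ENNReal) + 1) * ∫⁻ lam, μ (Prod.mk lam ⁻¹' T) ∂ρ := by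
      rw [← lintegral_const_mul _ (measurable_measure_prodMk_left hTm)]
      rfl
    rw [e1, ← Measure.prod_apply hTm, Measure.prod_apply_symm hTm]
    have e2 : ∀ ω', ρ ((fun x => (x, ω')) ⁻¹' T) ≤
        ∑' n, ENNReal.ofReal (2 / δ * (1 / ((m : ℝ) + 1)) * (a⁻¹) ^ (n + 1)) *
          (Agree pat X n ω).indicator (fun _ => 1) ω' := by
      intro ω'
      refine le_trans ?_ (vol_bound_sum pat X ha ha1 hb hδ hT ω ω' hm0)
      rw [hρ, Measure.restrict_apply (hTm.preimage (by fun_prop))]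
      refine measure_mono ?_
      rintro lam ⟨h1, h2⟩
      refine ⟨h2, ?_⟩
      have h3 : |PsiE pat X lam ω - PsiE pat X lam ω'| ≤ 1 / ((m : ℝ) + 1) := h1
      have h4 : 0 ≤ lam := ha.le.trans h2.1
      have h5 : lam < 1 := h2.2.trans_lt hb
      rwa [PsiE_eq pat X h4 h5, PsiE_eq pat X h4 h5] at h3
    have e3 : ∫⁻ ω', ρ ((fun x => (x, ω')) ⁻¹' T) ∂μ ≤
        ∑' n, ENNReal.ofReal (2 / δ * (1 / ((m : ℝ) + 1)) * (a⁻¹) ^ (n + 1)) *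
          μ (Agree pat X n ω) := by
      refine (lintegral_mono e2).trans (le_of_eq ?_)
      rw [lintegral_tsum]
      · refine tsum_congr fun n => ?_
        have hAm := Agree_measurable pat X hX n ω
        rw [lintegral_const_mul _ (measurable_const.indicator hAm)]
        congr 1
        exact lintegral_indicator_one hAm
      · intro n
        exact ((measurable_const.indicator (Agree_measurable pat X hX n ω)).const_mul _).aemeasurable
    refine (mul_le_mul_right e3 _).trans (le_of_eq ?_)
    rw [← ENNReal.tsum_mul_left, ← ENNReal.tsum_mul_left]
    refine tsum_congr fun n => ?_
    rw [← mul_assoc, ← mul_assoc]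
    congr 1
    have : ((m : ENNReal) + 1) = ENNReal.ofReal ((m : ℝ) + 1) := by
      rw [ENNReal.ofReal_add (by positivity) one_pos.le]; simp
    rw [this, ← ENNReal.ofReal_mul (by positivity), ← ENNReal.ofReal_mul (by positivity)]
    congr 1
    field_simp
  have h1 : ∀ᵐ ω ∂μ, ∀ᵐ lam ∂ρ, liminf (fun m => F m (lam, ω)) atTop < ⊤ := by
    filter_upwards [hG] with ω hω
    refine ae_lt_top (hLm.comp (measurable_id.prodMk measurable_const)) ?_
    refine ne_top_of_le_ne_top (ENNReal.mul_ne_top (ENNReal.ofReal_ne_top (r := 2 / δ)) hω)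
      ((lintegral_liminf_le fun m => (hFm m).comp (measurable_id.prodMk measurable_const)).trans
        (b := liminf (fun m => ∫⁻ lam, F m (lam, ω) ∂ρ) atTop) ?_)
    exact liminf_le_of_le (by isBoundedDefault) fun b hb => by
      obtain ⟨m, hm⟩ := hb.exists
      exact hm.trans (hbound ω m)
  have h2 : ∀ᵐ lam ∂ρ, ∀ᵐ ω ∂μ, liminf (fun m => F m (lam, ω)) atTop < ⊤ := by
    rw [Measure.ae_ae_comm]
    · exact h1
    · exact measurableSet_lt hLm measurable_const
  filter_upwards [h2, ae_restrict_mem measurableSet_Icc] with lam hlam hmem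
  have h4 : 0 ≤ lam := ha.le.trans hmem.1
  have h5 : lam < 1 := hmem.2.trans_lt hb
  have he : Psi pat X lam = PsiE pat X lam := by
    ext ω; rw [PsiE_eq pat X h4 h5]
  rw [he]
  refine ac_of_frequently μ (PsiE pat X lam) (hPm.comp (measurable_const.prodMk measurable_id)) ?_
  filter_upwards [hlam] with ω hω
  obtain ⟨M, hM⟩ := ENNReal.exists_nat_gt hω.ne
  refine ⟨M, (frequently_lt_of_liminf_lt (by isBoundedDefault) hM).mono fun m hm => ?_⟩
  have hm' : ((m : ENNReal) + 1) * μ {ω' | |PsiE pat X lam ω - PsiE pat X lam ω'| ≤ 1 / ((m : ℝ) + 1)}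
      < M := hm
  have : ENNReal.ofReal (1 / ((m : ℝ) + 1)) = ((m : ENNReal) + 1)⁻¹ := by
    rw [one_div, ENNReal.ofReal_inv_of_pos (by positivity), ENNReal.ofReal_add (by positivity) one_pos.le]
    simp
  rw [this, ← div_eq_mul_inv]
  rw [ENNReal.le_div_iff_mul_le (Or.inl (by simp)) (Or.inl (by simp)), mul_comm]
  exact hm'.le

theorem core_full {Ω : Type*} [MeasurableSpace Ω] {μ : Measure Ω} (pat : ℕ → Bool)
    (L r : ℕ) (hL : 1 ≤ L) (hr : 1 ≤ r)
    (hcount : ∀ n, ((Finset.Ico n (n + L)).filter (fun k => pat k = true)).card = r)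
    (X : ℕ → Ω → Bool) (hX : ∀ k, Measurable (X k)) (hI : iIndepFun X μ)
    (w : ℕ → ℝ) (hw0 : ∀ k, 0 ≤ w k) (hw1 : ∀ k, w k ≤ 1)
    (hf : ∀ k, μ (X k ⁻¹' {false}) = ENNReal.ofReal (w k))
    (ht : ∀ k, μ (X k ⁻¹' {true}) = ENNReal.ofReal (1 - w k))
    {p : ℝ} (hp0 : 0 < p) (hp1 : p < 1) (hw : Tendsto w atTop (𝓝 p))
    {a b : ℝ} (ha : 0 < a) (ha1 : a ≤ 1) (hb : b < 1) (hT : Transv pat a b)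
    (hent : r * (p * Real.log p + (1 - p) * Real.log (1 - p)) < L * Real.log a) :
    ∀ᵐ lam ∂(volume.restrict (Set.Icc a b)), μ.map (Psi pat X lam) ≪ volume := by
  obtain ⟨s, hs0, hs1, hS⟩ := summable_core pat L r hL hr hcount w hw0 hw1 hp0 hp1 hw ha hent
  exact core_ae pat X hX hI ha ha1 hb hT (G_finite pat X hX hI w hw0 hw1 hf ht ha hs0 hs1 hS)

lemma Psi_measurable_sup {Ω : Type*} (pat : ℕ → Bool) (X : ℕ → Ω → Bool)
    {lam : ℝ} (h0 : 0 ≤ lam) (h1 : lam < 1) :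
    MeasurableSpace.comap (Psi pat X lam) (borel ℝ) ≤
      ⨆ k ∈ {k | pat k = true}, MeasurableSpace.comap (X k) ⊤ := by
  set m : MeasurableSpace Ω := ⨆ k ∈ {k | pat k = true}, MeasurableSpace.comap (X k) ⊤ with hm
  set Y : ℕ → Ω → Bool := fun k ω => pat k && X k ω with hY
  have hYm : ∀ k, Measurable[m] (Y k) := by
    intro k
    cases hp : pat k
    · have : Y k = fun _ => false := by ext ω; simp [hY, hp]
      rw [this]; exact measurable_const
    · have : Y k = X k := by ext ω; simp [hY, hp]
      rw [this]
      have hle : MeasurableSpace.comap (X k) ⊤ ≤ m := le_iSup₂_of_le k hp le_rfl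
      exact measurable_iff_comap_le.2 hle
  have e : Psi pat X lam = PsiE pat Y lam := by
    ext ω
    rw [PsiE_eq pat Y h0 h1]
    simp [Psi, hY]
  rw [e]
  have := (PsiE_measurable pat Y hYm).comp (measurable_const (a := lam) |>.prodMk measurable_id)
  have h2 := measurable_iff_comap_le.1 this
  rw [← BorelSpace.measurable_eq (α := ℝ)]
  exact h2

lemma Psi_measurable {Ω : Type*} [MeasurableSpace Ω] (pat : ℕ → Bool) (X : ℕ → Ω → Bool)
    (hX : ∀ k, Measurable (X k)) {lam : ℝ} (h0 : 0 ≤ lam) (h1 : lam < 1) :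
    Measurable (Psi pat X lam) := by
  have e : Psi pat X lam = PsiE pat X lam := by
    ext ω
    rw [PsiE_eq pat X h0 h1]
  rw [e]
  exact (PsiE_measurable pat X hX).comp (measurable_const.prodMk measurable_id)

lemma split_ac {Ω : Type*} [MeasurableSpace Ω] {μ : Measure Ω} (pat : ℕ → Bool)
    (X : ℕ → Ω → Bool) (hX : ∀ k, Measurable (X k)) (hI : iIndepFun X μ)
    {lam : ℝ} (h0 : 0 ≤ lam) (h1 : lam < 1) (h : μ.map (Psi pat X lam) ≪ volume) :
    μ.map (fun ω => ∑' k : ℕ, if X k ω then lam ^ (k + 1) else 0) ≪ volume := by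
  have hprob := hI.isProbabilityMeasure
  set q : ℕ → Bool := fun k => !(pat k) with hq
  have e : (fun ω => ∑' k : ℕ, if X k ω then lam ^ (k + 1) else 0)
      = Psi q X lam + Psi pat X lam := by
    ext ω
    simp only [Pi.add_apply, Psi]
    rw [← (Psi_summable q X h0 h1 ω).tsum_add (Psi_summable pat X h0 h1 ω)]
    refine tsum_congr fun k => ?_
    cases hp : pat k <;> cases hx : X k ω <;> simp [hq, hp]
  have hind : IndepFun (Psi q X lam) (Psi pat X lam) μ := by
    rw [IndepFun_iff_Indep]
    have := indep_iSup_of_disjoint (m := fun k => MeasurableSpace.comap (X k) ⊤) (μ := μ)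
      (fun k => measurable_iff_comap_le.1 (hX k)) hI.iIndep
      (S := {k | q k = true}) (T := {k | pat k = true}) (by
        rw [Set.disjoint_left]; intro k hk hk'
        simp only [Set.mem_ofPred_eq, hq] at hk hk'
        simp [hk'] at hk)
    rw [BorelSpace.measurable_eq (α := ℝ)]
    exact indep_of_indep_of_le_left (indep_of_indep_of_le_right this (Psi_measurable_sup pat X h0 h1))
      (Psi_measurable_sup q X h0 h1)
  rw [e, hind.map_add_eq_map_conv_map (Psi_measurable q X hX h0 h1) (Psi_measurable pat X hX h0 h1)]
  have hm := Psi_measurable pat X hX h0 h1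
  have : IsProbabilityMeasure (μ.map (Psi pat X lam)) := Measure.isProbabilityMeasure_map hm.aemeasurable
  exact Measure.conv_absolutelyContinuous h

lemma Psi_dyadic {Ω : Type*} (pat : ℕ → Bool) (X : ℕ → Ω → Bool) (D : ℕ) (hD : 1 ≤ D) (lam : ℝ) :
    Psi (fun k => decide ((k + 1) % D = 0) && pat ((k + 1) / D - 1)) X lam
      = Psi pat (fun m => X (D * (m + 1) - 1)) (lam ^ D) := by
  have hpos : ∀ m, 1 ≤ D * (m + 1) := fun m => Nat.mul_pos hD (Nat.succ_pos m)
  have hinj : Function.Injective (fun m : ℕ => D * (m + 1) - 1) := by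
    intro m n h
    have h1 := hpos m
    have h2 := hpos n
    have : D * (m + 1) = D * (n + 1) := by simp only at h; omega
    have := Nat.eq_of_mul_eq_mul_left hD this
    omega
  ext ω
  unfold Psi
  rw [← hinj.tsum_eq]
  · refine tsum_congr fun m => ?_
    have h1 : D * (m + 1) - 1 + 1 = D * (m + 1) := Nat.sub_add_cancel (hpos m)
    rw [h1]
    simp [h1, Nat.mul_div_cancel_left (m + 1) hD, pow_mul]
  · intro k hk
    simp only [Function.mem_support] at hk
    have h2 : (k + 1) % D = 0 := by
      by_contra hc
      apply hk
      simp [hc]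
    obtain ⟨c, hc⟩ := Nat.dvd_of_mod_eq_zero h2
    have hc0 : c ≠ 0 := by rintro rfl; simp at hc
    refine ⟨c - 1, ?_⟩
    simp only
    rw [Nat.sub_add_cancel (Nat.one_le_iff_ne_zero.2 hc0), ← hc]
    simp

lemma null_pow {N : Set ℝ} (hN : volume N = 0) (D : ℕ) (hD : 1 ≤ D) :
    volume {x : ℝ | 0 < x ∧ x ^ D ∈ N} = 0 := by
  have hD0 : (D : ℝ) ≠ 0 := by positivity
  have h1 : volume ((fun x : ℝ => x ^ ((D : ℝ)⁻¹)) '' (N ∩ Set.Ioi 0)) = 0 := by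
    refine addHaar_image_eq_zero_of_differentiableOn_of_addHaar_eq_zero volume ?_
      (measure_mono_null Set.inter_subset_left hN)
    intro x hx
    exact (Real.differentiableAt_rpow_const_of_ne _ (ne_of_gt hx.2)).differentiableWithinAt
  refine measure_mono_null ?_ h1
  rintro x ⟨h0, hx⟩
  refine ⟨x ^ D, ⟨hx, Set.mem_Ioi.2 (pow_pos h0 D)⟩, ?_⟩
  simp only
  exact Real.pow_rpow_inv_natCast h0.le (by omega)

lemma entropy_bound {p : ℝ} (hp : p ∈ Set.Icc (1 / 3 : ℝ) (2 / 3)) :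
    3 * (p * Real.log p + (1 - p) * Real.log (1 - p)) ≤ Real.log (4 / 27) := by
  have key : ∀ q : ℝ, 1 / 3 ≤ q → q ≤ 1 / 2 → Real.binEntropy (1 / 3) ≤ Real.binEntropy q := by
    intro q h1 h2
    exact Real.binEntropy_strictMonoOn.monotoneOn ⟨by norm_num, by norm_num⟩
      ⟨by linarith, by norm_num at h2 ⊢; linarith⟩ h1
  have h1 : Real.binEntropy (1 / 3) ≤ Real.binEntropy p := by
    rcases le_total p (1 / 2) with h | h
    · exact key p hp.1 h
    · rw [← Real.binEntropy_one_sub p]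
      exact key (1 - p) (by linarith [hp.2]) (by linarith)
  have h2 : Real.binEntropy p = -(p * Real.log p + (1 - p) * Real.log (1 - p)) := by
    unfold Real.binEntropy; rw [Real.log_inv, Real.log_inv]; ring
  have h3 : Real.log (4 / 27) = - (3 * Real.binEntropy (1 / 3)) := by
    unfold Real.binEntropy
    have : (4 / 27 : ℝ) = (1 / 3) * (2 / 3) ^ 2 := by norm_num
    rw [this, Real.log_mul (by norm_num) (by norm_num), Real.log_pow, Real.log_inv, Real.log_inv]
    norm_num
    ring
  rw [h3]
  linarith

lemma log_cmp {a : ℝ} (ha : 0 < a) (L r : ℕ) {h : ℝ} (hr : 1 ≤ r)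
    (hh : 3 * h ≤ Real.log (4 / 27)) (hc : (4 / 27 : ℝ) ^ r < a ^ (3 * L)) :
    r * h < L * Real.log a := by
  have h1 := Real.log_lt_log (by positivity) hc
  rw [Real.log_pow, Real.log_pow] at h1
  push_cast at h1
  have : (r : ℝ) * (3 * h) ≤ r * Real.log (4 / 27) := mul_le_mul_of_nonneg_left hh (by positivity)
  linarith

lemma periodic_count (pat : ℕ → Bool) (L r : ℕ) (hper : ∀ k, pat (k + L) = pat k)
    (h : Nat.count (fun k => pat k = true) L = r) (n : ℕ) :
    ((Finset.Ico n (n + L)).filter (fun k => pat k = true)).card = r := by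
  rw [Nat.filter_Ico_card_eq_of_periodic n L _ (fun k => by rw [hper]), h]

theorem base_ae {Ω : Type*} [MeasurableSpace Ω] {μ : Measure Ω}
    (X : ℕ → Ω → Bool) (hX : ∀ k, Measurable (X k)) (hI : iIndepFun X μ)
    (w : ℕ → ℝ) (hw0 : ∀ k, 0 ≤ w k) (hw1 : ∀ k, w k ≤ 1)
    (hf : ∀ k, μ (X k ⁻¹' {false}) = ENNReal.ofReal (w k))
    (ht : ∀ k, μ (X k ⁻¹' {true}) = ENNReal.ofReal (1 - w k))
    {p : ℝ} (hp : p ∈ Set.Icc (1 / 3 : ℝ) (2 / 3)) (hw : Tendsto w atTop (𝓝 p))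
    {t : ℝ} (ht0 : 0 < t) (htl : Real.log t = p * Real.log p + (1 - p) * Real.log (1 - p)) :
    ∀ᵐ lam : ℝ, lam ∈ Set.Icc t (73 / 100) → ∃ pat, μ.map (Psi pat X lam) ≪ volume := by
  have hp0 : 0 < p := by linarith [hp.1]
  have hp1 : p < 1 := by linarith [hp.2]
  have hE := entropy_bound hp
  have core : ∀ (pat : ℕ → Bool) (L r : ℕ) (_ : 1 ≤ L) (_ : 1 ≤ r)
      (_ : ∀ k, pat (k + L) = pat k) (_ : Nat.count (fun k => pat k = true) L = r)
      (a b : ℝ) (_ : 0 < a) (_ : a ≤ 1) (_ : b < 1) (_ : Transv pat a b)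
      (_ : r * (p * Real.log p + (1 - p) * Real.log (1 - p)) < L * Real.log a),
      ∀ᵐ lam : ℝ, lam ∈ Set.Icc a b → μ.map (Psi pat X lam) ≪ volume := by
    intro pat L r hL hr hper hc a b ha ha1 hb hT hent
    rw [← ae_restrict_iff' measurableSet_Icc]
    exact core_full pat L r hL hr (periodic_count pat L r hper hc) X hX hI w hw0 hw1 hf ht hp0 hp1 hw
      ha ha1 hb hT hent
  have A1 : ∀ᵐ lam : ℝ, ∀ n : ℕ, lam ∈ Set.Icc (t + 1 / ((n : ℝ) + 1)) (63 / 100) →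
      μ.map (Psi pat1 X lam) ≪ volume := by
    rw [ae_all_iff]
    intro n
    have hn : (0:ℝ) < 1 / ((n : ℝ) + 1) := by positivity
    by_cases h1 : t + 1 / ((n : ℝ) + 1) ≤ 1
    · refine core pat1 1 1 le_rfl le_rfl (fun _ => rfl) (by decide) _ _ (by linarith) h1 (by norm_num)
        (transv1 (by linarith)) ?_
      rw [← htl]
      have := Real.log_lt_log ht0 (show t < t + 1 / ((n : ℝ) + 1) by linarith)
      simpa using this
    · refine Eventually.of_forall fun lam hlam => ?_
      have h2 := hlam.1
      have h3 := hlam.2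
      exact absurd (h2.trans h3) (by linarith)
  have A4 := core pat4 4 3 (by norm_num) (by norm_num) (fun k => by simp [pat4]) (by decide)
    (63 / 100) (66 / 100) (by norm_num) (by norm_num) (by norm_num) (transv4 (by norm_num))
    (log_cmp (by norm_num) 4 3 (by norm_num) hE (by norm_num))
  have A3 := core pat3 3 2 (by norm_num) (by norm_num) (fun k => by simp [pat3]) (by decide)
    (66 / 100) (69 / 100) (by norm_num) (by norm_num) (by norm_num) (transv3 (by norm_num))
    (log_cmp (by norm_num) 3 2 (by norm_num) hE (by norm_num))
  have A5 := core pat5 5 3 (by norm_num) (by norm_num) (fun k => by simp [pat5]) (by decide)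
    (69 / 100) (73 / 100) (by norm_num) (by norm_num) (by norm_num) (transv5 (by norm_num))
    (log_cmp (by norm_num) 5 3 (by norm_num) hE (by norm_num))
  have hne : ∀ᵐ lam : ℝ, lam ≠ t := by
    rw [ae_iff]; simp
  filter_upwards [A1, A4, A3, A5, hne] with lam h1 h4 h3 h5 hne hmem
  rcases le_total lam (63 / 100) with h | h
  · have hlt : t < lam := lt_of_le_of_ne hmem.1 (Ne.symm hne)
    obtain ⟨n, hn⟩ := exists_nat_one_div_lt (sub_pos.2 hlt)
    exact ⟨pat1, h1 n ⟨by linarith, h⟩⟩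
  rcases le_total lam (66 / 100) with h' | h'
  · exact ⟨pat4, h4 ⟨h, h'⟩⟩
  rcases le_total lam (69 / 100) with h'' | h''
  · exact ⟨pat3, h3 ⟨h', h''⟩⟩
  · exact ⟨pat5, h5 ⟨h'', hmem.2⟩⟩

theorem full_ae {Ω : Type*} [MeasurableSpace Ω] {μ : Measure Ω}
    (X : ℕ → Ω → Bool) (hX : ∀ k, Measurable (X k)) (hI : iIndepFun X μ)
    (w : ℕ → ℝ) (hw0 : ∀ k, 0 ≤ w k) (hw1 : ∀ k, w k ≤ 1)
    (hf : ∀ k, μ (X k ⁻¹' {false}) = ENNReal.ofReal (w k))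
    (ht : ∀ k, μ (X k ⁻¹' {true}) = ENNReal.ofReal (1 - w k))
    {p : ℝ} (hp : p ∈ Set.Icc (1 / 3 : ℝ) (2 / 3)) (hw : Tendsto w atTop (𝓝 p))
    {t : ℝ} (ht0 : 0 < t) (htl : Real.log t = p * Real.log p + (1 - p) * Real.log (1 - p)) :
    ∀ᵐ lam : ℝ, lam ∈ Set.Ico t 1 →
      μ.map (fun ω => ∑' k : ℕ, if X k ω then lam ^ (k + 1) else 0) ≪ volume := by
  have hE := entropy_bound hp
  have htb : t ≤ (73 / 100) ^ 2 := by
    by_contra hc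
    push Not at hc
    have h1 : ((73 / 100 : ℝ) ^ 2) ^ 3 < t ^ 3 := by gcongr
    have h2 : (4 / 27 : ℝ) < t ^ 3 := lt_trans (by norm_num) h1
    have h3 := Real.log_lt_log (by norm_num) h2
    rw [Real.log_pow, htl] at h3
    push_cast at h3
    linarith
  have hall : ∀ᵐ lam : ℝ, ∀ j : ℕ, 0 < lam → lam ^ (2 ^ j) ∈ Set.Icc t (73 / 100) →
      ∃ pat, μ.map (Psi pat X lam) ≪ volume := by
    rw [ae_all_iff]
    intro j
    have hD : 1 ≤ 2 ^ j := Nat.one_le_two_pow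
    have hpos : ∀ m, 1 ≤ 2 ^ j * (m + 1) := fun m => Nat.mul_pos hD (Nat.succ_pos m)
    have hle : ∀ m, m ≤ 2 ^ j * (m + 1) - 1 := by
      intro m
      have : 1 * (m + 1) ≤ 2 ^ j * (m + 1) := Nat.mul_le_mul_right _ hD
      omega
    have hinj : Function.Injective (fun m : ℕ => 2 ^ j * (m + 1) - 1) := by
      intro m n h
      have h1 := hpos m
      have h2 := hpos n
      have : 2 ^ j * (m + 1) = 2 ^ j * (n + 1) := by simp only at h; omega
      have := Nat.eq_of_mul_eq_mul_left hD this
      omega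
    have htend : Tendsto (fun m : ℕ => 2 ^ j * (m + 1) - 1) atTop atTop :=
      tendsto_atTop_mono hle tendsto_id
    have hb := base_ae (fun m => X (2 ^ j * (m + 1) - 1)) (fun m => hX _) (hI.precomp hinj)
      (fun m => w (2 ^ j * (m + 1) - 1)) (fun m => hw0 _) (fun m => hw1 _) (fun m => hf _)
      (fun m => ht _) hp (hw.comp htend) ht0 htl
    rw [ae_iff] at hb
    have hn := null_pow hb (2 ^ j) hD
    rw [ae_iff]
    refine measure_mono_null ?_ hn
    intro lam hlam
    simp only [Set.mem_ofPred_eq, not_forall] at hlam ⊢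
    obtain ⟨h0, hmem, hno⟩ := hlam
    refine ⟨h0, hmem, ?_⟩
    rintro ⟨pat, hpat⟩
    apply hno
    rw [← Psi_dyadic pat X (2 ^ j) hD lam] at hpat
    exact ⟨_, hpat⟩
  filter_upwards [hall] with lam hlam hmem
  have h0 : 0 < lam := ht0.trans_le hmem.1
  have hex : ∃ j : ℕ, lam ^ (2 ^ j) ≤ 73 / 100 := by
    have h1 := (tendsto_pow_atTop_nhds_zero_of_lt_one h0.le hmem.2).comp
      (tendsto_pow_atTop_atTop_of_one_lt (r := 2) one_lt_two)
    obtain ⟨j, hj⟩ := ((tendsto_order.1 h1).2 (73 / 100) (by norm_num)).exists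
    exact ⟨j, hj.le⟩
  classical
  have hspec := Nat.find_spec hex
  have hlow : t ≤ lam ^ (2 ^ (Nat.find hex)) := by
    rcases Nat.eq_zero_or_pos (Nat.find hex) with hz | hpz
    · rw [hz]; simpa using hmem.1
    · have hmin := Nat.find_min hex (m := Nat.find hex - 1) (by omega)
      push Not at hmin
      have e : 2 ^ (Nat.find hex) = 2 ^ (Nat.find hex - 1) * 2 := by
        rw [← pow_succ, Nat.sub_add_cancel hpz]
      rw [e, pow_mul]
      refine htb.trans ?_
      gcongr
  obtain ⟨pat, hpat⟩ := hlam (Nat.find hex) h0 ⟨hlow, hspec⟩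
  exact split_ac pat X hX hI h0.le hmem.2 hpat

theorem main_aux
    (p₀ p₁ : ℕ → ℝ) (h₀ : ∀ k, 0 ≤ p₀ k) (h₁ : ∀ k, 0 ≤ p₁ k)
    (hsum : ∀ k, p₀ k + p₁ k = 1)
    (p : ℝ) (hp : p ∈ Set.Icc (1 / 3 : ℝ) (2 / 3))
    (hsq : Summable fun k => (p - p₀ k) ^ 2)
    (P : Measure (ℕ → Bool))
    (hP : IsProductMeasure (fun k => _root_.bernoulliMeasure (p₀ k) (p₁ k)) P) :
    ∀ᵐ lam ∂(volume.restrict (Set.Ico (p ^ p * (1 - p) ^ (1 - p)) 1)),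
      Measure.map (fun ω : ℕ → Bool => ∑' k : ℕ, if ω k then lam ^ (k + 1) else 0) P
        ≪ volume := by
  have hprob : IsProbabilityMeasure P := ⟨by simpa using hP ∅ (fun _ => Set.univ)⟩
  have hX : ∀ k, Measurable (fun ω : ℕ → Bool => ω k) := fun k => measurable_pi_apply k
  have hmar : ∀ k (E : Set Bool), P ((fun ω : ℕ → Bool => ω k) ⁻¹' E)
      = _root_.bernoulliMeasure (p₀ k) (p₁ k) E := by
    intro k E
    have := hP {k} (fun _ => E)
    simp only [Finset.mem_singleton, forall_eq, Finset.prod_singleton] at this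
    exact this
  have hI : iIndepFun (fun (k : ℕ) (ω : ℕ → Bool) => ω k) P := by
    rw [iIndepFun_iff_measure_inter_preimage_eq_mul]
    intro S sets _
    have h1 := hP S sets
    have h2 : (⋂ i ∈ S, (fun ω : ℕ → Bool => ω i) ⁻¹' sets i) = {ω | ∀ k ∈ S, ω k ∈ sets k} := by
      ext ω; simp
    rw [h2, h1]
    exact Finset.prod_congr rfl fun k _ => (hmar k _).symm
  have hw : Tendsto p₀ atTop (𝓝 p) := by
    have h1 := hsq.tendsto_atTop_zero
    have h2 : Tendsto (fun k => |p - p₀ k|) atTop (𝓝 0) := by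
      have := (Real.continuous_sqrt.tendsto 0).comp h1
      simpa [Function.comp_def, Real.sqrt_sq_eq_abs] using this
    have h3 := (tendsto_zero_iff_abs_tendsto_zero _).2 h2
    have h4 := (tendsto_const_nhds (x := p)).sub h3
    simpa using h4
  have hp0 : 0 < p := by linarith [hp.1]
  have hp1 : 0 < 1 - p := by linarith [hp.2]
  have ht0 : 0 < p ^ p * (1 - p) ^ (1 - p) := by positivity
  have htl : Real.log (p ^ p * (1 - p) ^ (1 - p))
      = p * Real.log p + (1 - p) * Real.log (1 - p) := by
    rw [Real.log_mul (by positivity) (by positivity), Real.log_rpow hp0, Real.log_rpow hp1]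
  have := full_ae (μ := P) (fun k ω => ω k) hX hI p₀ h₀ (fun k => by linarith [h₁ k, hsum k])
    (fun k => by rw [hmar]; simp [_root_.bernoulliMeasure])
    (fun k => by rw [hmar, ← hsum k]; simp [_root_.bernoulliMeasure]) hp hw ht0 htl
  rwa [← ae_restrict_iff' measurableSet_Ico] at this

end Helpers

/-- If there is `p ∈ [1/3, 2/3]` with `∑ (p - p₀ₖ)² < ∞`, then for Lebesgue-almost
every `λ ∈ [pᵖ (1-p)^{1-p}, 1)` the distribution of `ψ = ∑_{k=1}^∞ ψₖ λᵏ` (where the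
`ψₖ` are independent with `P(ψₖ = 0) = p₀ₖ`, `P(ψₖ = 1) = p₁ₖ`) is absolutely
continuous with respect to Lebesgue measure on `ℝ`. -/
theorem absolutelyContinuous_of_summable_sq_p
    (p₀ p₁ : ℕ → ℝ) (h₀ : ∀ k, 0 ≤ p₀ k) (h₁ : ∀ k, 0 ≤ p₁ k)
    (hsum : ∀ k, p₀ k + p₁ k = 1)
    (p : ℝ) (hp : p ∈ Set.Icc (1 / 3 : ℝ) (2 / 3))
    (hsq : Summable fun k => (p - p₀ k) ^ 2)
    (P : Measure (ℕ → Bool))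
    (hP : IsProductMeasure (fun k => bernoulliMeasure (p₀ k) (p₁ k)) P) :
    ∀ᵐ lam ∂(volume.restrict (Set.Ico (p ^ p * (1 - p) ^ (1 - p)) 1)),
      Measure.map (fun ω : ℕ → Bool => ∑' k : ℕ, if ω k then lam ^ (k + 1) else 0) P
        ≪ volume := by
  exact main_aux p₀ p₁ h₀ h₁ hsum p hp hsq P hP
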